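/- Let G be a connected finite graph with a set P of exactly 4 longest paths such that f(G,P) ≥ 1. Then ℓ(G) ≥ 3·f(G,P) + 1. -/

import Mathlib

open SimpleGraph

/-- `w` is a longest path of `G`: it is a path and no path of `G` is longer. -/
def IsLongestPath {V : Type*} (G : SimpleGraph V) {u v : V} (w : G.Walk u v) : Prop :=
  w.IsPath ∧ ∀ (a b : V) (q : G.Walk a b), q.IsPath → q.length ≤ w.length

/-- The distance `d_G(x, V(w))` from a vertex `x` to the vertex set of a walk `w`. -/
noncomputable def distToWalk {V : Type*} (G : SimpleGraph V) (x : V) {u v : V}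
    (w : G.Walk u v) : ℕ :=
  sInf {d : ℕ | ∃ y ∈ w.support, G.dist x y = d}

/-- The path-distance-function `f(G, 𝒫)` of a family `𝒫` of paths of `G`. -/
noncomputable def pdf {V : Type*} (G : SimpleGraph V) {k : ℕ}
    (P : Fin k → Σ u : V, Σ v : V, G.Walk u v) : ℕ :=
  sInf {s : ℕ | ∃ x : V, s = ∑ i, distToWalk G x (P i).2.2}

namespace LongestPaths

variable {V : Type*} {G : SimpleGraph V}

theorem isChain_reverse_of_adj {l : List V} (h : l.IsChain G.Adj) : l.reverse.IsChain G.Adj := by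
  rw [List.isChain_reverse]
  exact h.imp fun _ _ hab => hab.symm

theorem isChain_join {x : V} {A B : List V} (hA : (x :: A).IsChain G.Adj)
    (hB : (x :: B).IsChain G.Adj) : (A.reverse ++ x :: B).IsChain G.Adj := by
  rw [List.isChain_split]
  exact ⟨by simpa using isChain_reverse_of_adj hA, hB⟩

theorem isChain_cons_reverse {x z : V} {A : List V} (h : (x :: (A ++ [z])).IsChain G.Adj) :
    (z :: (A.reverse ++ [x])).IsChain G.Adj := by
  simpa using isChain_reverse_of_adj h

/-- Two paths of maximal order `N`, one consisting of the rays `A` and `B` issuing from `x`, the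
other of the rays `C` and `D` issuing from `y`, joined by a path from `x` to `y` whose interior `S`
avoids both. -/
structure Bridge (G : SimpleGraph V) (N : ℕ) (x y : V) (A B C D S : List V) : Prop where
  length_le : ∀ l : List V, l.IsChain G.Adj → l.Nodup → l.length ≤ N
  chainA : (x :: A).IsChain G.Adj
  chainB : (x :: B).IsChain G.Adj
  chainC : (y :: C).IsChain G.Adj
  chainD : (y :: D).IsChain G.Adj
  chainS : (x :: (S ++ [y])).IsChain G.Adj
  nodupP : (x :: (A ++ B)).Nodup
  nodupQ : (y :: (C ++ D)).Nodup
  nodupS : (x :: (S ++ [y])).Nodup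
  disjP : ∀ v ∈ y :: S, v ∉ A ∧ v ∉ B
  disjQ : ∀ v ∈ x :: S, v ∉ C ∧ v ∉ D
  lengthP : A.length + B.length + 1 = N
  lengthQ : C.length + D.length + 1 = N

namespace Bridge

variable {N : ℕ} {x y : V} {A B C D S : List V}

theorem swapP (h : Bridge G N x y A B C D S) : Bridge G N x y B A C D S where
  __ := h
  chainA := h.chainB
  chainB := h.chainA
  nodupP := (List.perm_append_comm.cons x).nodup_iff.mp h.nodupP
  disjP v hv := (h.disjP v hv).symm
  lengthP := by have := h.lengthP; omega

theorem symm (h : Bridge G N x y A B C D S) : Bridge G N y x C D A B S.reverse where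
  length_le := h.length_le
  chainA := h.chainC
  chainB := h.chainD
  chainC := h.chainA
  chainD := h.chainB
  chainS := isChain_cons_reverse h.chainS
  nodupP := h.nodupQ
  nodupQ := h.nodupP
  nodupS := by simpa using List.nodup_reverse.mpr h.nodupS
  disjP v hv := h.disjQ v (by simpa using hv)
  disjQ v hv := h.disjP v (by simpa using hv)
  lengthP := h.lengthQ
  lengthQ := h.lengthP

theorem swapQ (h : Bridge G N x y A B C D S) : Bridge G N x y A B D C S := by
  simpa using h.symm.swapP.symm

theorem length_lt_of_disjoint (h : Bridge G N x y A B C D S) (hAD : ∀ v ∈ A, v ∉ D) :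
    D.length + S.length + 1 ≤ B.length := by
  obtain ⟨hle, hA, hB, hC, hD, hS, nP, nQ, nS, dP, dQ, lP, lQ⟩ := h
  have hc : (A.reverse ++ x :: (S ++ y :: D)).IsChain G.Adj :=
    isChain_join hA (List.isChain_cons_split.mpr ⟨hS, hD⟩)
  have hn : (A.reverse ++ x :: (S ++ y :: D)).Nodup := by
    simp only [List.nodup_append, List.nodup_cons, List.mem_append, List.mem_cons,
      List.nodup_reverse, List.mem_reverse] at *
    grind
  have := hle _ hc hn
  simp at this
  omega

theorem not_disjoint (h : Bridge G N x y A B C D S) (hA : ∀ v ∈ A, v ∉ C ∧ v ∉ D)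
    (hC : ∀ v ∈ C, v ∉ A ∧ v ∉ B) : False := by
  have h1 := h.length_lt_of_disjoint fun v hv => (hA v hv).2
  have h2 := h.swapP.swapQ.length_lt_of_disjoint fun v hv hv' => (hC v hv').2 hv
  have h3 := h.lengthP
  have h4 := h.lengthQ
  have h5 := h.symm.length_lt_of_disjoint fun v hv hv' => (hC v hv).2 hv'
  simp at h5
  omega

theorem le_of_first_hit {z : V} {A₁ A₂ C₁ C₂ : List V}
    (h : Bridge G N x y (A₁ ++ z :: A₂) B (C₁ ++ z :: C₂) D S)
    (hA : ∀ v ∈ A₁, v ∉ C₁ ++ z :: C₂ ∧ v ∉ D) :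
    S.length + A₁.length + 1 ≤ C₁.length ∧ S.length + A₁.length + 1 ≤ C₂.length := by
  obtain ⟨hle, cA, cB, cC, cD, cS, nP, nQ, nS, dP, dQ, lP, lQ⟩ := h
  rw [List.isChain_cons_split] at cA cC
  have hc₁ : (C₂.reverse ++ z :: (A₁.reverse ++ x :: (S ++ y :: D))).IsChain G.Adj :=
    isChain_join cC.2 (List.isChain_cons_split.mpr
      ⟨isChain_cons_reverse cA.1, List.isChain_cons_split.mpr ⟨cS, cD⟩⟩)
  have hc₂ : (y :: (S.reverse ++ x :: (A₁ ++ z :: (C₁.reverse ++ y :: D)))).IsChain G.Adj :=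
    List.isChain_cons_split.mpr ⟨isChain_cons_reverse cS, List.isChain_cons_split.mpr
      ⟨cA.1, List.isChain_cons_split.mpr ⟨isChain_cons_reverse cC.1, cD⟩⟩⟩
  have hn₁ : (C₂.reverse ++ z :: (A₁.reverse ++ x :: (S ++ y :: D))).Nodup := by
    clear hle hc₁ hc₂ cA cB cC cD cS
    simp only [List.nodup_append, List.nodup_cons, List.mem_append, List.mem_cons,
      List.nodup_reverse, List.mem_reverse] at *
    grind
  have hn₂ : (S.reverse ++ x :: (A₁ ++ z :: (C₁.reverse ++ y :: D))).Nodup := by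
    clear hle hc₁ hc₂ cA cB cC cD cS
    simp only [List.nodup_append, List.nodup_cons, List.mem_append, List.mem_cons,
      List.nodup_reverse, List.mem_reverse] at *
    grind
  have h₁ := hle _ hc₁ hn₁
  have h₂ := hle _ hc₂.tail hn₂
  simp at h₁ h₂ lQ
  omega

theorem le_of_two_hits {z z' : V} {A₁ A₂ B₁ B₂ C₁ C₂ C₃ : List V}
    (h : Bridge G N x y (A₁ ++ z :: A₂) (B₁ ++ z' :: B₂) (C₁ ++ z :: (C₂ ++ z' :: C₃)) D S)
    (hA : ∀ v ∈ A₁, v ∉ C₁ ++ z :: (C₂ ++ z' :: C₃) ∧ v ∉ D)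
    (hB : ∀ v ∈ B₁, v ∉ C₁ ++ z :: (C₂ ++ z' :: C₃) ∧ v ∉ D) :
    3 * S.length + 6 ≤ N := by
  have hz := h.le_of_first_hit hA
  have hz' : S.length + B₁.length + 1 ≤ C₃.length := by
    have h' : Bridge G N x y (B₁ ++ z' :: B₂) (A₁ ++ z :: A₂) ((C₁ ++ z :: C₂) ++ z' :: C₃) D S := by
      simpa using h.swapP
    exact (h'.le_of_first_hit (by simpa using hB)).2
  obtain ⟨hle, cA, cB, cC, cD, cS, nP, nQ, nS, dP, dQ, lP, lQ⟩ := h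
  rw [List.isChain_cons_split] at cA cB
  obtain ⟨cC₁, cC₂⟩ := List.isChain_cons_split.mp cC
  obtain ⟨-, cC₃⟩ := List.isChain_cons_split.mp cC₂
  have hc : (x :: (S ++ y :: (C₁ ++ z :: (A₁.reverse ++ x :: (B₁ ++ z' :: C₃))))).IsChain G.Adj :=
    List.isChain_cons_split.mpr ⟨cS, List.isChain_cons_split.mpr ⟨cC₁, List.isChain_cons_split.mpr
      ⟨isChain_cons_reverse cA.1, List.isChain_cons_split.mpr ⟨cB.1, cC₃⟩⟩⟩⟩
  have hn : (S ++ y :: (C₁ ++ z :: (A₁.reverse ++ x :: (B₁ ++ z' :: C₃)))).Nodup := by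
    clear hle hc cA cB cC cC₁ cC₂ cC₃ cD cS
    simp only [List.nodup_append, List.nodup_cons, List.mem_append, List.mem_cons,
      List.nodup_reverse, List.mem_reverse] at *
    grind
  have := hle _ hc.tail hn
  simp at this lQ
  omega

end Bridge

theorem exists_first_mem {p : V → Prop} {l : List V} (h : ∃ v ∈ l, p v) :
    ∃ l₁ z l₂, l = l₁ ++ z :: l₂ ∧ p z ∧ ∀ v ∈ l₁, ¬ p v := by
  induction l with
  | nil => simp at h
  | cons a l ih =>
    by_cases ha : p a
    · exact ⟨[], a, l, rfl, ha, by simp⟩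
    · obtain ⟨l₁, z, l₂, rfl, hz, hl⟩ := ih (by simpa [ha] using h)
      exact ⟨a :: l₁, z, l₂, rfl, hz, by simpa [ha] using hl⟩

namespace Bridge

variable {N : ℕ} {x y : V} {A B C D S : List V}

theorem le_of_both_hit (h : Bridge G N x y A B C D S) (hA : ∃ v ∈ A, v ∈ C ∨ v ∈ D)
    (hB : ∃ v ∈ B, v ∈ C ∨ v ∈ D) : 3 * S.length + 6 ≤ N := by
  obtain ⟨A₁, z, A₂, rfl, hz, hA₁⟩ := exists_first_mem hA
  obtain ⟨B₁, z', B₂, rfl, hz', hB₁⟩ := exists_first_mem hB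
  simp only [not_or] at hA₁ hB₁
  have hne : z ≠ z' := by
    have := h.nodupP
    grind
  have same : ∀ {C D : List V},
      Bridge G N x y (A₁ ++ z :: A₂) (B₁ ++ z' :: B₂) C D S → z ∈ C → z' ∈ C →
      (∀ v ∈ A₁, v ∉ C ∧ v ∉ D) → (∀ v ∈ B₁, v ∉ C ∧ v ∉ D) → 3 * S.length + 6 ≤ N := by
    intro C D h hz hz' hA₁ hB₁
    obtain ⟨C₁, C₂, rfl⟩ := List.append_of_mem hz
    rcases List.mem_append.mp hz' with hz' | hz'
    · obtain ⟨C₁, C₃, rfl⟩ := List.append_of_mem hz'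
      simp only [List.append_assoc, List.cons_append] at h hA₁ hB₁
      exact h.swapP.le_of_two_hits hB₁ hA₁
    · obtain ⟨C₂, C₃, rfl⟩ := List.append_of_mem ((List.mem_cons.mp hz').resolve_left hne.symm)
      exact h.le_of_two_hits hA₁ hB₁
  have opposite : ∀ {C D : List V},
      Bridge G N x y (A₁ ++ z :: A₂) (B₁ ++ z' :: B₂) C D S → z ∈ C → z' ∈ D →
      (∀ v ∈ A₁, v ∉ C ∧ v ∉ D) → (∀ v ∈ B₁, v ∉ C ∧ v ∉ D) → 3 * S.length + 6 ≤ N := by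
    intro C D h hz hz' hA₁ hB₁
    obtain ⟨C₁, C₂, rfl⟩ := List.append_of_mem hz
    obtain ⟨D₁, D₂, rfl⟩ := List.append_of_mem hz'
    have h₁ := h.le_of_first_hit hA₁
    have h₂ := h.swapP.swapQ.le_of_first_hit fun v hv => (hB₁ v hv).symm
    have := h.lengthQ
    simp at this
    omega
  have hA₂ := fun v hv => (hA₁ v hv).symm
  have hB₂ := fun v hv => (hB₁ v hv).symm
  rcases hz with hz | hz <;> rcases hz' with hz' | hz'
  · exact same h hz hz' hA₁ hB₁
  · exact opposite h hz hz' hA₁ hB₁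
  · exact opposite h.swapQ hz hz' hA₂ hB₂
  · exact same h.swapQ hz hz' hA₂ hB₂

theorem exists_mem_and_le (h : Bridge G N x y A B C D S) :
    (∃ v, (v ∈ A ∨ v ∈ B) ∧ (v ∈ C ∨ v ∈ D)) ∧ 3 * S.length + 6 ≤ N := by
  have key : ((∃ v ∈ A, v ∈ C ∨ v ∈ D) ∧ ∃ v ∈ B, v ∈ C ∨ v ∈ D) ∨
      ((∃ v ∈ C, v ∈ A ∨ v ∈ B) ∧ ∃ v ∈ D, v ∈ A ∨ v ∈ B) := by
    have h₁ := h.not_disjoint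
    have h₂ := h.swapP.not_disjoint
    have h₃ := h.swapQ.not_disjoint
    have h₄ := h.swapP.swapQ.not_disjoint
    grind
  rcases key with ⟨hA, hB⟩ | ⟨hC, hD⟩
  · exact ⟨by grind, h.le_of_both_hit hA hB⟩
  · exact ⟨by grind, by simpa using h.symm.le_of_both_hit hC hD⟩

end Bridge

/-- A path of order `3 * |S| + 6` exists as soon as two longest paths `p` and `q` are joined by a
path with interior `S` avoiding both; moreover `p` and `q` meet. -/
theorem bridge_bound {N : ℕ} (hN : ∀ l : List V, l.IsChain G.Adj → l.Nodup → l.length ≤ N)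
    {p q S : List V} {x y : V} (hp : p.IsChain G.Adj) (hp' : p.Nodup) (hpN : p.length = N)
    (hq : q.IsChain G.Adj) (hq' : q.Nodup) (hqN : q.length = N)
    (hS : (x :: (S ++ [y])).IsChain G.Adj) (hS' : (x :: (S ++ [y])).Nodup)
    (hx : x ∈ p) (hy : y ∈ q) (hSp : ∀ v ∈ S ++ [y], v ∉ p) (hSq : ∀ v ∈ x :: S, v ∉ q) :
    (∃ v ∈ p, v ∈ q) ∧ 3 * S.length + 6 ≤ N := by
  obtain ⟨A, B, rfl⟩ := List.append_of_mem hx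
  obtain ⟨C, D, rfl⟩ := List.append_of_mem hy
  rw [List.isChain_split] at hp hq
  have h : Bridge G N x y A.reverse B C.reverse D S :=
    { length_le := hN
      chainA := by simpa using isChain_reverse_of_adj hp.1
      chainB := hp.2
      chainC := by simpa using isChain_reverse_of_adj hq.1
      chainD := hq.2
      chainS := hS
      nodupP := by
        simp only [List.nodup_append, List.nodup_cons, List.mem_append, List.mem_cons,
          List.nodup_reverse, List.mem_reverse] at *
        grind
      nodupQ := by
        simp only [List.nodup_append, List.nodup_cons, List.mem_append, List.mem_cons,
          List.nodup_reverse, List.mem_reverse] at *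
        grind
      nodupS := hS'
      disjP := fun v hv => by
        have := hSp v (by simp at hv ⊢; tauto)
        simp at this ⊢
        tauto
      disjQ := fun v hv => by
        have := hSq v hv
        simp at this ⊢
        tauto
      lengthP := by simp at hpN ⊢; omega
      lengthQ := by simp at hqN ⊢; omega }
  obtain ⟨⟨v, hv⟩, hle⟩ := h.exists_mem_and_le
  exact ⟨⟨v, by grind⟩, hle⟩

theorem exists_minimal_sublist {ι : Type*} (s : ι → V → Prop) (l : List V)
    (hl : ∀ i, ∃ v ∈ l, s i v) :
    ∃ T, T <:+: l ∧ (∀ i, ∃ v ∈ T, s i v) ∧ (∀ x T', T = x :: T' → ∃ i, ∀ v ∈ T', ¬ s i v) ∧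
      ∀ y T', T = T' ++ [y] → ∃ i, ∀ v ∈ T', ¬ s i v := by
  induction hn : l.length using Nat.strong_induction_on generalizing l with
  | _ n ih =>
    by_cases h₁ : ∃ x T', l = x :: T' ∧ ∀ i, ∃ v ∈ T', s i v
    · obtain ⟨x, T', rfl, h⟩ := h₁
      obtain ⟨T, hT, h'⟩ := ih _ (by simp at hn; omega) T' h rfl
      exact ⟨T, hT.trans (List.suffix_cons x T').isInfix, h'⟩
    by_cases h₂ : ∃ y T', l = T' ++ [y] ∧ ∀ i, ∃ v ∈ T', s i v
    · obtain ⟨y, T', rfl, h⟩ := h₂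
      obtain ⟨T, hT, h'⟩ := ih _ (by simp at hn; omega) T' h rfl
      exact ⟨T, hT.trans (List.prefix_append T' [y]).isInfix, h'⟩
    · push Not at h₁ h₂
      exact ⟨l, List.infix_rfl, hl, h₁, h₂⟩

/-- A list meeting all the sets `s i` either meets their intersection, or contains a bridge between
two of them that still meets all of them. -/
theorem exists_bridge {ι : Type*} [Nonempty ι] (s : ι → V → Prop) (l : List V)
    (hl : ∀ i, ∃ v ∈ l, s i v) :
    (∃ x ∈ l, ∀ i, s i x) ∨ ∃ x y S i j, x :: (S ++ [y]) <:+: l ∧ s i x ∧ s j y ∧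
      (∀ v ∈ S ++ [y], ¬ s i v) ∧ (∀ v ∈ x :: S, ¬ s j v) ∧
      ∀ k, ∃ v ∈ x :: (S ++ [y]), s k v := by
  obtain ⟨T, hT, hs, h₁, h₂⟩ := exists_minimal_sublist s l hl
  rcases T with _ | ⟨x, T⟩
  · obtain ⟨v, hv, -⟩ := hs (Classical.arbitrary ι)
    simp at hv
  rcases List.eq_nil_or_concat T with rfl | ⟨S, y, rfl⟩
  · exact .inl ⟨x, hT.subset (by simp), by simpa using hs⟩
  · right
    obtain ⟨i, hi⟩ := h₁ x _ rfl
    obtain ⟨j, hj⟩ := h₂ y (x :: S) (by simp)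
    simp only [List.concat_eq_append] at *
    refine ⟨x, y, S, i, j, hT, ?_, ?_, hi, hj, hs⟩
    · obtain ⟨v, hv, hv'⟩ := hs i
      grind
    · obtain ⟨v, hv, hv'⟩ := hs j
      grind

theorem dist_le_of_isChain (hG : G.Connected) {x z : V} {l₁ : List V} :
    (x :: (l₁ ++ [z])).IsChain G.Adj → G.dist x z ≤ l₁.length + 1 := by
  induction l₁ generalizing x with
  | nil => intro h; simp at h; exact (SimpleGraph.dist_eq_one_iff_adj.mpr h).le
  | cons a l ih =>
    intro h
    rw [List.cons_append, List.isChain_cons_cons] at h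
    have h₁ := ih h.2
    have h₂ := hG.dist_triangle (u := x) (v := a) (w := z)
    rw [SimpleGraph.dist_eq_one_iff_adj.mpr h.1] at h₂
    simp
    omega

theorem dist_add_dist_le (hG : G.Connected) {x y v : V} {S : List V}
    (h : (x :: (S ++ [y])).IsChain G.Adj) (hv : v ∈ x :: (S ++ [y])) :
    G.dist v x + G.dist v y ≤ S.length + 1 := by
  have hxy := dist_le_of_isChain hG h
  simp only [List.mem_cons, List.mem_append, List.not_mem_nil, or_false] at hv
  rcases hv with rfl | hv | rfl
  · simpa using hxy
  · obtain ⟨S₁, S₂, rfl⟩ := List.append_of_mem hv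
    rw [List.append_assoc, List.cons_append, List.isChain_cons_split] at h
    have h₁ := dist_le_of_isChain hG h.1
    have h₂ := dist_le_of_isChain hG h.2
    rw [SimpleGraph.dist_comm] at h₁
    simp
    omega
  · rw [SimpleGraph.dist_comm]
    simpa using hxy

theorem distToWalk_le {x y u v : V} {w : G.Walk u v} (hy : y ∈ w.support) :
    distToWalk G x w ≤ G.dist x y :=
  Nat.sInf_le ⟨y, hy, rfl⟩

theorem distToWalk_eq_zero {x u v : V} {w : G.Walk u v} (hx : x ∈ w.support) :
    distToWalk G x w = 0 := by
  simpa using distToWalk_le (x := x) hx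

theorem _root_.IsLongestPath.length_le {u v : V} {w : G.Walk u v} (hw : IsLongestPath G w)
    (l : List V) (hl : l.IsChain G.Adj) (hl' : l.Nodup) : l.length ≤ w.support.length := by
  rcases eq_or_ne l [] with rfl | hne
  · simp
  · have := hw.2 _ _ (SimpleGraph.Walk.ofSupport l hne hl)
      (SimpleGraph.Walk.IsPath.mk' (by rwa [SimpleGraph.Walk.support_ofSupport]))
    rw [SimpleGraph.Walk.length_ofSupport] at this
    rw [SimpleGraph.Walk.length_support]
    omega

theorem _root_.IsLongestPath.length_support_eq {u v u' v' : V} {w : G.Walk u v} {w' : G.Walk u' v'}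
    (hw : IsLongestPath G w) (hw' : IsLongestPath G w') :
    w.support.length = w'.support.length :=
  le_antisymm
    (hw'.length_le _ w.isChain_adj_support hw.1.support_nodup)
    (hw.length_le _ w'.isChain_adj_support hw'.1.support_nodup)

theorem bridge_bound_of_isLongestPath {u v u' v' x y : V} {w : G.Walk u v} {w' : G.Walk u' v'}
    (hw : IsLongestPath G w) (hw' : IsLongestPath G w') {S : List V}
    (hS : (x :: (S ++ [y])).IsChain G.Adj) (hS' : (x :: (S ++ [y])).Nodup)
    (hx : x ∈ w.support) (hy : y ∈ w'.support) (hSp : ∀ v ∈ S ++ [y], v ∉ w.support)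
    (hSq : ∀ v ∈ x :: S, v ∉ w'.support) :
    (∃ v ∈ w.support, v ∈ w'.support) ∧ 3 * S.length + 5 ≤ w.length := by
  have := bridge_bound hw.length_le w.isChain_adj_support hw.1.support_nodup rfl
    w'.isChain_adj_support hw'.1.support_nodup (hw'.length_support_eq hw)
    hS hS' hx hy hSp hSq
  refine ⟨this.1, ?_⟩
  have h := this.2
  rw [SimpleGraph.Walk.length_support] at h
  omega

/-- Any two longest paths of a connected graph meet. -/
theorem _root_.IsLongestPath.exists_mem_support (hG : G.Connected) {u v u' v' : V} {w : G.Walk u v}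
    {w' : G.Walk u' v'} (hw : IsLongestPath G w) (hw' : IsLongestPath G w') :
    ∃ x ∈ w.support, x ∈ w'.support := by
  obtain ⟨r, hr⟩ := (hG.preconnected u u').exists_isPath
  have hl : ∀ b : Bool, ∃ x ∈ r.support, x ∈ cond b w.support w'.support := by
    rintro (_ | _)
    · exact ⟨u', by simp, by simp⟩
    · exact ⟨u, by simp, by simp⟩
  rcases exists_bridge (fun (b : Bool) x => x ∈ cond b w.support w'.support) r.support hl with
    ⟨x, -, hx⟩ | ⟨x, y, S, i, j, hT, hi, hj, hSi, hSj, -⟩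
  · exact ⟨x, hx true, hx false⟩
  · have hc := r.isChain_adj_support.infix hT
    have hn := hr.support_nodup.sublist hT.sublist
    have hx := hSj x (by simp)
    rcases i with _ | _ <;> rcases j with _ | _
    · exact absurd hi hx
    · obtain ⟨z, hz, hz'⟩ :=
        (bridge_bound_of_isLongestPath hw' hw hc hn hi hj hSi hSj).1
      exact ⟨z, hz', hz⟩
    · exact (bridge_bound_of_isLongestPath hw hw' hc hn hi hj hSi hSj).1
    · exact absurd hi hx

end LongestPaths

open LongestPaths

/-- (**) in the proof of Theorem 2: for four longest paths with `f(G,𝒫) ≥ 1`,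
`ℓ(G) ≥ 3·f(G,𝒫) + 1`; here `ℓ(G)` is the length of the longest path `P 0`. -/
theorem length_lower_bound_four {V : Type*} [Fintype V] (G : SimpleGraph V)
    (hG : G.Connected) (P : Fin 4 → Σ u : V, Σ v : V, G.Walk u v)
    (hinj : Function.Injective P) (hlong : ∀ i, IsLongestPath G (P i).2.2)
    (hf : 1 ≤ pdf G P) :
    3 * pdf G P + 1 ≤ (P 0).2.2.length := by
  have hpdf : ∀ v, pdf G P ≤ ∑ i, distToWalk G v (P i).2.2 := fun v => Nat.sInf_le ⟨v, rfl⟩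
  rcases exists_bridge (fun (i : Fin 3) v => v ∈ (P i.succ).2.2.support) (P 0).2.2.support
    (fun i => (hlong 0).exists_mem_support hG (hlong i.succ)) with
    ⟨x, hx, hx'⟩ | ⟨x, y, S, i, j, hT, hi, hj, hSi, hSj, hk⟩
  · have h := hpdf x
    rw [Fin.sum_univ_succ, distToWalk_eq_zero hx,
      Finset.sum_eq_zero fun i _ => distToWalk_eq_zero (hx' i)] at h
    omega
  · have hc := (P 0).2.2.isChain_adj_support.infix hT
    have hn := (hlong 0).1.support_nodup.sublist hT.sublist
    have hbound :=
      (bridge_bound_of_isLongestPath (hlong i.succ) (hlong j.succ) hc hn hi hj hSi hSj).2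
    have hlen := (hlong i.succ).2 _ _ (P 0).2.2 (hlong 0).1
    have hlen' := (hlong 0).2 _ _ (P i.succ).2.2 (hlong i.succ).1
    have hij : i ≠ j := by
      rintro rfl
      exact hSj x (by simp) hi
    have hsum : ∃ k, ∀ g : Fin 3 → ℕ, ∑ l, g l = g i + g j + g k := by
      refine ⟨-(i + j), fun g => ?_⟩
      rw [Fin.sum_univ_three]
      fin_cases i <;> fin_cases j <;> first | exact absurd rfl hij | skip
      all_goals simp [Fin.neg_def, Fin.add_def]
      all_goals omega
    obtain ⟨k, hsum⟩ := hsum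
    obtain ⟨v, hv, hvk⟩ := hk k
    have h := hpdf v
    rw [Fin.sum_univ_succ, distToWalk_eq_zero (hT.subset hv), hsum, distToWalk_eq_zero hvk] at h
    have h₁ := distToWalk_le (x := v) hi
    have h₂ := distToWalk_le (x := v) hj
    have h₃ := dist_add_dist_le hG hc hv
    omega
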